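/- Let q be a prime power, F_q the finite field with q elements, and d a positive integer. Let A₁,...,A_d, B₁,...,B_d ⊆ F_q be subsets with ∏_{j=1}^d |A_j|·|B_j| > q^(d+1). Then every nonzero element of F_q lies in A₁·B₁ + A₂·B₂ + ... + A_d·B_d = {a₁b₁ + ... + a_d b_d : a_j ∈ A_j, b_j ∈ B_j}. -/

import Mathlib

theorem aux_fiber {V W : Type*} [AddCommGroup V] [AddCommGroup W] [Fintype V] [Fintype W]
    [DecidableEq W] (φ : V →+ W) (hφ : Function.Surjective φ) (w : W) :
    (Fintype.card W) * (Finset.univ.filter (fun x => φ x = w)).card = Fintype.card V := by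
  have h1 := Finset.card_eq_sum_card_fiberwise (s := (Finset.univ : Finset V))
    (t := (Finset.univ : Finset W)) (f := φ) (by intro x _; simp)
  have h2 : ∀ b ∈ (Finset.univ : Finset W), (Finset.univ.filter (fun x => φ x = b)).card =
      (Finset.univ.filter (fun x => φ x = w)).card := by
    intro b _
    exact AddMonoidHom.card_fiber_eq_of_mem_range φ (hφ b) (hφ w)
  rw [Finset.sum_congr rfl h2, Finset.sum_const, smul_eq_mul, Finset.card_univ,
    Finset.card_univ] at h1
  exact h1.symm

theorem aux_one {F : Type*} [Field F] [Fintype F] [DecidableEq F] {d : ℕ} (y : Fin d → F)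
    (hy : y ≠ 0) (t : F) :
    Fintype.card F * (Finset.univ.filter (fun x : Fin d → F => x ⬝ᵥ y = t)).card
      = Fintype.card F ^ d := by
  have := aux_fiber (AddMonoidHom.mk' (fun x : Fin d → F => x ⬝ᵥ y)
    (fun a b => add_dotProduct a b y)) (by
      intro u
      obtain ⟨i, hi⟩ := Function.ne_iff.1 hy
      refine ⟨Pi.single i (u / y i), ?_⟩
      simp only [AddMonoidHom.mk'_apply, single_dotProduct]
      exact div_mul_cancel₀ _ hi) t
  simpa using this

theorem aux_two {F : Type*} [Field F] [Fintype F] [DecidableEq F] {d : ℕ} (y z : Fin d → F)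
    (hy : y ≠ z) (t : F) (ht : t ≠ 0) :
    Fintype.card F ^ 2 * (Finset.univ.filter
      (fun x : Fin d → F => x ⬝ᵥ y = t ∧ x ⬝ᵥ z = t)).card ≤ Fintype.card F ^ d := by
  rcases (Finset.univ.filter
      (fun x : Fin d → F => x ⬝ᵥ y = t ∧ x ⬝ᵥ z = t)).eq_empty_or_nonempty with h0 | ⟨x0, hx0⟩
  · rw [h0]; simp
  obtain ⟨h1, h2⟩ := (Finset.mem_filter.1 hx0).2
  obtain ⟨i, hi⟩ := Function.ne_iff.1 hy
  have hi' : y i - z i ≠ 0 := sub_ne_zero.2 hi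
  have := aux_fiber (AddMonoidHom.mk' (fun x : Fin d → F => (x ⬝ᵥ y, x ⬝ᵥ z))
    (fun a b => by simp [add_dotProduct])) (by
      rintro ⟨u, v⟩
      refine ⟨Pi.single i ((u - v) / (y i - z i)) +
        ((u - (u - v) / (y i - z i) * y i) / t) • x0, ?_⟩
      simp only [AddMonoidHom.mk'_apply, add_dotProduct, single_dotProduct, smul_dotProduct,
        h1, h2, smul_eq_mul, Prod.mk.injEq]
      constructor <;> field_simp <;> ring) (t, t)
  simp only [AddMonoidHom.mk'_apply, Prod.mk.injEq, Fintype.card_prod, Fintype.card_fun,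
    Fintype.card_fin] at this
  rw [sq]
  exact this.le

theorem aux_main {F : Type*} [Field F] [Fintype F] [DecidableEq F] {d : ℕ}
    (E G : Finset (Fin d → F)) (hG : (0 : Fin d → F) ∉ G) (t : F) (ht : t ≠ 0)
    (hEG : ∀ x ∈ E, ∀ y ∈ G, x ⬝ᵥ y ≠ t) :
    (E.card : ℝ) * G.card ≤ (Fintype.card F : ℝ) ^ d * (Fintype.card F - 1) := by
  set q : ℝ := (Fintype.card F : ℝ) with hq
  have hq1 : 1 < q := by
    rw [hq]; exact_mod_cast Fintype.one_lt_card
  have hq0 : 0 < q := by linarith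
  set g : ℝ := (G.card : ℝ) with hg
  let I : (Fin d → F) → (Fin d → F) → ℝ := fun x y => if x ⬝ᵥ y = t then 1 else 0
  let f : (Fin d → F) → ℝ := fun x => ∑ y ∈ G, I x y
  have hI1 : ∀ y ∈ G, q * ∑ x, I x y = q ^ d := by
    intro y hy
    have := aux_one y (fun h => hG (h ▸ hy)) t
    simp only [I, Finset.sum_boole]
    rw [hq]; exact_mod_cast this
  have hf1 : q * ∑ x, f x = g * q ^ d := by
    simp only [f]
    rw [Finset.sum_comm, Finset.mul_sum, Finset.sum_congr rfl hI1]
    simp [hg]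
  have hI2 : ∀ y ∈ G, ∀ z ∈ G, q ^ 2 * ∑ x, I x y * I x z ≤
      q ^ d + if y = z then (q - 1) * q ^ d else 0 := by
    intro y hy z hz
    split_ifs with hyz
    · subst hyz
      have : ∑ x, I x y * I x y = ∑ x, I x y := by
        refine Finset.sum_congr rfl fun x _ => ?_
        simp only [I]; split_ifs <;> simp
      rw [this, sq, mul_assoc, hI1 y hy]
      linarith
    · have := aux_two y z hyz t ht
      have h2 : ∑ x, I x y * I x z = ((Finset.univ.filter
        (fun x : Fin d → F => x ⬝ᵥ y = t ∧ x ⬝ᵥ z = t)).card : ℝ) := by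
        rw [← Finset.sum_boole]
        refine Finset.sum_congr rfl fun x _ => ?_
        simp only [I, ite_and]; split_ifs <;> simp
      rw [h2, hq, add_zero]; exact_mod_cast this
  have hf2 : q ^ 2 * ∑ x, f x ^ 2 ≤ g * (g * q ^ d + (q - 1) * q ^ d) := by
    have e : ∑ x, f x ^ 2 = ∑ y ∈ G, ∑ z ∈ G, ∑ x, I x y * I x z := by
      simp only [f, sq, Finset.sum_mul_sum]
      rw [Finset.sum_comm]
      refine Finset.sum_congr rfl fun y _ => ?_
      rw [Finset.sum_comm]
    rw [e]
    simp only [Finset.mul_sum] at hI2 ⊢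
    calc _ ≤ ∑ y ∈ G, ∑ z ∈ G, (q ^ d + if y = z then (q - 1) * q ^ d else 0) :=
          Finset.sum_le_sum fun y hy => Finset.sum_le_sum fun z hz => hI2 y hy z hz
      _ = ∑ y ∈ G, (g * q ^ d + (q - 1) * q ^ d) := by
          refine Finset.sum_congr rfl fun y hy => ?_
          rw [Finset.sum_add_distrib, Finset.sum_ite_eq]
          simp [hy, hg]
      _ = _ := by simp [hg]; ring
  have hcard : ∑ _x : Fin d → F, (1 : ℝ) = q ^ d := by simp [hq]
  have hvar : ∑ x, (q * f x - g) ^ 2 ≤ g * (q - 1) * q ^ d := by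
    have e : ∑ x, (q * f x - g) ^ 2 = q ^ 2 * ∑ x, f x ^ 2 - 2 * g * (q * ∑ x, f x)
        + g ^ 2 * ∑ _x : Fin d → F, (1 : ℝ) := by
      simp only [Finset.mul_sum]
      rw [← Finset.sum_sub_distrib, ← Finset.sum_add_distrib]
      refine Finset.sum_congr rfl fun x _ => ?_
      ring
    rw [e, hf1, hcard]
    nlinarith
  have hlow : (E.card : ℝ) * g ^ 2 ≤ ∑ x, (q * f x - g) ^ 2 := by
    calc (E.card : ℝ) * g ^ 2 = ∑ x ∈ E, (q * f x - g) ^ 2 := by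
          rw [← nsmul_eq_mul, ← Finset.sum_const]
          refine Finset.sum_congr rfl fun x hx => ?_
          have : f x = 0 := Finset.sum_eq_zero fun y hy => by simp [I, hEG x hx y hy]
          rw [this]; ring
      _ ≤ _ := Finset.sum_le_sum_of_subset_of_nonneg (Finset.subset_univ _)
          fun x _ _ => sq_nonneg _
  have hgn : 0 ≤ g := by positivity
  rcases hgn.eq_or_lt with h0 | hpos
  · rw [← h0, mul_zero]
    exact mul_nonneg (by positivity) (by linarith)
  · have := hlow.trans hvar
    refine le_of_mul_le_mul_left ?_ hpos
    linarith

/-- If `∏ j, |A_j|·|B_j| > q^(d+1)`, then every nonzero element of `F_q` lies in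
`A₁·B₁ + ⋯ + A_d·B_d`. -/
theorem stmt_8 {F : Type*} [Field F] [Fintype F] (d : ℕ) (hd : 0 < d)
    (A B : Fin d → Finset F)
    (h : (∏ j, ((A j).card : ℝ) * ((B j).card : ℝ)) > (Fintype.card F : ℝ) ^ (d + 1)) :
    ∀ t : F, t ≠ 0 →
      ∃ a b : Fin d → F, (∀ j, a j ∈ A j) ∧ (∀ j, b j ∈ B j) ∧
        t = ∑ j, a j * b j := by
  classical
  intro t ht
  by_contra hcon
  have key := aux_main (Fintype.piFinset A) ((Fintype.piFinset B).erase 0)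
    (Finset.notMem_erase _ _) t ht (by
      intro x hx y hy hxy
      exact hcon ⟨x, y, Fintype.mem_piFinset.1 hx,
        Fintype.mem_piFinset.1 (Finset.mem_of_mem_erase hy), hxy.symm⟩)
  have hB : ((Fintype.piFinset B).card : ℝ) ≤ ((Fintype.piFinset B).erase 0).card + 1 := by
    have := Finset.pred_card_le_card_erase (s := Fintype.piFinset B) (a := 0)
    exact_mod_cast (by omega : (Fintype.piFinset B).card ≤ ((Fintype.piFinset B).erase 0).card + 1)
  have hE : ((Fintype.piFinset A).card : ℝ) ≤ (Fintype.card F : ℝ) ^ d := by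
    have := Finset.card_le_univ (Fintype.piFinset A)
    rw [Fintype.card_fun, Fintype.card_fin] at this
    exact_mod_cast this
  have hp : (∏ j, ((A j).card : ℝ) * ((B j).card : ℝ)) =
      ((Fintype.piFinset A).card : ℝ) * ((Fintype.piFinset B).card : ℝ) := by
    rw [Finset.prod_mul_distrib, Fintype.card_piFinset, Fintype.card_piFinset]
    push_cast; rfl
  rw [hp] at h
  have h3 := mul_le_mul_of_nonneg_left hB (Nat.cast_nonneg (α := ℝ) (Fintype.piFinset A).card)
  rw [pow_succ] at h
  linarith
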